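/- arXiv:2211.15193 — 3 statements merged into one kernel-verified Lean document; each statement's English description precedes it below -/
import Mathlib

section
/- For every prime p ≡ 5 or 11 (mod 24), the number of integer solutions (x,y) to p = 2x² + 3y² is exactly 4. -/
/-- The integer `-6` is a quadratic residue modulo a prime `p ≡ 5, 11 (mod 24)`. -/
theorem isSquare_neg_six_zmod (p : ℕ) [Fact p.Prime] (h : p % 24 = 5 ∨ p % 24 = 11) :
    IsSquare ((-6 : ℤ) : ZMod p) := by
  apply ZMod.isSquare_of_jacobiSym_eq_one
  rw [jacobiSym.mod_right (-6) (Nat.odd_iff.mpr (by omega))]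
  have h24 : 4 * (-6 : ℤ).natAbs = 24 := rfl
  rw [h24]
  rcases h with h | h <;> rw [h] <;> norm_num

/-- There is an integer `s` with `2 * s ^ 2 + 3` divisible by a prime `p ≡ 5, 11 (mod 24)`. -/
theorem exists_dvd_two_mul_sq_add_three (p : ℕ) [Fact p.Prime]
    (h : p % 24 = 5 ∨ p % 24 = 11) : ∃ s : ℤ, (p : ℤ) ∣ 2 * s ^ 2 + 3 := by
  obtain ⟨r, hr⟩ := isSquare_neg_six_zmod p h
  have h2 : (2 : ZMod p) ≠ 0 := by
    intro h0
    have hdvd : p ∣ 2 := (ZMod.natCast_eq_zero_iff 2 p).mp (by exact_mod_cast h0)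
    have := Nat.le_of_dvd (by norm_num) hdvd
    omega
  obtain ⟨s, hs⟩ := ZMod.intCast_surjective (r / 2)
  refine ⟨s, (ZMod.intCast_zmod_eq_zero_iff_dvd _ p).mp ?_⟩
  have hrs : r = 2 * s := by rw [hs]; field_simp
  apply mul_left_cancel₀ h2
  push_cast at hr ⊢
  rw [hrs] at hr
  linear_combination -hr

/-- Lemma of Thue: every residue `s` modulo `p` is a quotient of two small integers. -/
theorem exists_small_sub_mul (p : ℕ) (hp : 0 < p) (s : ℤ) :
    ∃ x y : ℤ, 0 < y ∧ x ^ 2 < p ∧ y ^ 2 ≤ p ∧ (p : ℤ) ∣ x - s * y := by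
  obtain ⟨j, k, hk, hkn, hjk⟩ := Real.exists_int_int_abs_mul_sub_le ((s : ℝ) / p)
    (Nat.sqrt_pos.mpr hp)
  have hlt : (p : ℤ) < (p.sqrt + 1) ^ 2 := by exact_mod_cast Nat.lt_succ_sqrt' p
  have hle : (p.sqrt : ℤ) ^ 2 ≤ p := by exact_mod_cast Nat.sqrt_le' p
  have hp' : (0 : ℤ) < p := by exact_mod_cast hp
  have hpR : (0 : ℝ) < p := by exact_mod_cast hp
  refine ⟨k * s - j * p, k, hk, ?_, by nlinarith, ⟨-j, by ring⟩⟩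
  have hbound : |((k * s - j * p : ℤ) : ℝ)| * (p.sqrt + 1) ≤ p := by
    have heq : ((k * s - j * p : ℤ) : ℝ) = (k * (s / p) - j) * p := by
      push_cast
      field_simp
    rw [le_div_iff₀ (by positivity)] at hjk
    rw [heq, abs_mul, abs_of_pos hpR]
    nlinarith
  have hbound' : |k * s - j * p| * (p.sqrt + 1) ≤ (p : ℤ) := by exact_mod_cast hbound
  have hsq := pow_le_pow_left₀ (by positivity) hbound' 2
  rw [mul_pow, sq_abs] at hsq
  by_contra! hcon
  nlinarith

/-- A number congruent to `2` modulo `3` is not of the form `x ^ 2 + 6 * y ^ 2`. -/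
theorem sq_add_six_mul_sq_ne {n : ℤ} (hn : n % 3 = 2) (x y : ℤ) : x ^ 2 + 6 * y ^ 2 ≠ n := by
  intro h
  have h3 : x ^ 2 % 3 = 2 := by omega
  rcases (by omega : x % 3 = 0 ∨ x % 3 = 1 ∨ x % 3 = 2) with hx | hx | hx <;>
    simp [pow_two, Int.mul_emod, hx] at h3

/-- Every prime `p ≡ 5, 11 (mod 24)` is represented by `2 * x ^ 2 + 3 * y ^ 2`. -/
theorem exists_two_mul_sq_add_three_mul_sq (p : ℕ) (hp : p.Prime)
    (h : p % 24 = 5 ∨ p % 24 = 11) : ∃ x y : ℤ, 2 * x ^ 2 + 3 * y ^ 2 = p := by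
  have := Fact.mk hp
  obtain ⟨s, hs⟩ := exists_dvd_two_mul_sq_add_three p h
  obtain ⟨x, y, hy, hxp, hyp, hxy⟩ := exists_small_sub_mul p hp.pos s
  have hp3 : (p : ℤ) % 3 = 2 := by omega
  have hdvd : (p : ℤ) ∣ 2 * x ^ 2 + 3 * y ^ 2 := by
    have heq : 2 * x ^ 2 + 3 * y ^ 2 =
        (x - s * y) * (2 * (x + s * y)) + (2 * s ^ 2 + 3) * y ^ 2 := by ring
    rw [heq]
    exact dvd_add (hxy.mul_right _) (hs.mul_right _)
  obtain ⟨k, hk⟩ := hdvd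
  have hp0 : (0 : ℤ) < p := by exact_mod_cast hp.pos
  have hk0 : 0 < k := by
    by_contra! hcon
    nlinarith [sq_nonneg x]
  have hk5 : k < 5 := by
    by_contra! hcon
    nlinarith
  interval_cases k
  · exact ⟨x, y, by linarith⟩
  · have h2 : (2 : ℤ) ∣ y := Int.prime_two.dvd_of_dvd_pow (n := 2) (by omega)
    obtain ⟨z, rfl⟩ := h2
    exact (sq_add_six_mul_sq_ne hp3 x z (by linarith)).elim
  · have h3 : (3 : ℤ) ∣ x := Int.prime_three.dvd_of_dvd_pow (n := 2) (by omega)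
    obtain ⟨z, rfl⟩ := h3
    exact (sq_add_six_mul_sq_ne hp3 y z (by linarith)).elim
  · have h2 : (2 : ℤ) ∣ y := Int.prime_two.dvd_of_dvd_pow (n := 2) (by omega)
    obtain ⟨z, rfl⟩ := h2
    have hx : x ^ 2 + 6 * z ^ 2 = 2 * p := by linarith
    have h2 : (2 : ℤ) ∣ x := Int.prime_two.dvd_of_dvd_pow (n := 2) (by omega)
    obtain ⟨w, rfl⟩ := h2
    exact ⟨w, z, by linarith⟩

/-- A prime is represented by `2 * x ^ 2 + 3 * y ^ 2` in at most one way up to signs. -/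
theorem sq_eq_sq_of_two_mul_sq_add_three_mul_sq {p : ℕ} (hp : p.Prime) {x y u v : ℤ}
    (hxy : 2 * x ^ 2 + 3 * y ^ 2 = p) (huv : 2 * u ^ 2 + 3 * v ^ 2 = p) :
    u ^ 2 = x ^ 2 ∧ v ^ 2 = y ^ 2 := by
  have hp0 : (0 : ℤ) < p := by exact_mod_cast hp.pos
  have hpZ : Prime (p : ℤ) := Nat.prime_iff_prime_int.mp hp
  have eq_zero_of_dvd (a b : ℤ) (hab : a ^ 2 + 6 * b ^ 2 = (p : ℤ) ^ 2) (hd : (p : ℤ) ∣ b) :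
      b = 0 := by
    refine Int.eq_zero_of_abs_lt_dvd hd (abs_lt_of_sq_lt_sq ?_ hp0.le)
    by_contra! hcon
    nlinarith [sq_nonneg a]
  have hprod : 2 * ((x * v - y * u) * (x * v + y * u)) = p * (v ^ 2 - y ^ 2) := by
    linear_combination v ^ 2 * hxy - y ^ 2 * huv
  have hzero : (x * v - y * u) * (x * v + y * u) = 0 := by
    have hnorm : (2 * x * u + 3 * y * v) ^ 2 + 6 * (x * v - y * u) ^ 2 = (p : ℤ) ^ 2 := by
      linear_combination (2 * u ^ 2 + 3 * v ^ 2) * hxy + p * huv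
    have hnorm' : (2 * x * u - 3 * y * v) ^ 2 + 6 * (x * v + y * u) ^ 2 = (p : ℤ) ^ 2 := by
      linear_combination (2 * u ^ 2 + 3 * v ^ 2) * hxy + p * huv
    have hd : (p : ℤ) ∣ 2 * ((x * v - y * u) * (x * v + y * u)) := ⟨_, hprod⟩
    rcases hpZ.dvd_or_dvd hd with h2 | hd
    · have hle := Int.le_of_dvd (by norm_num) h2
      have hp2 : (p : ℤ) = 2 := by
        have : (2 : ℤ) ≤ p := by exact_mod_cast hp.two_le
        omega
      have hy : y = 0 := by
        rw [hp2] at hxy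
        by_contra hy
        have := sq_nonneg x
        have : 0 < y ^ 2 := by positivity
        omega
      have hv : v = 0 := by
        rw [hp2] at huv
        by_contra hv
        have := sq_nonneg u
        have : 0 < v ^ 2 := by positivity
        omega
      simp [hy, hv]
    · rcases hpZ.dvd_or_dvd hd with hd | hd
      · rw [eq_zero_of_dvd _ _ hnorm hd, zero_mul]
      · rw [eq_zero_of_dvd _ _ hnorm' hd, mul_zero]
  rw [hzero, mul_zero, zero_eq_mul, or_iff_right hp0.ne'] at hprod
  constructor <;> linarith

theorem stmt8 (p : ℕ) (hp : p.Prime) (h : p % 24 = 5 ∨ p % 24 = 11) :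
    Nat.card {q : ℤ × ℤ // 2 * q.1 ^ 2 + 3 * q.2 ^ 2 = (p : ℤ)} = 4 := by
  obtain ⟨x, y, hxy⟩ := exists_two_mul_sq_add_three_mul_sq p hp h
  have hx : x ≠ 0 := by
    rintro rfl
    omega
  have hy : y ≠ 0 := by
    rintro rfl
    omega
  have hsol (q : ℤ × ℤ) : 2 * q.1 ^ 2 + 3 * q.2 ^ 2 = (p : ℤ) ↔
      q ∈ ({x, -x} ×ˢ {y, -y} : Finset (ℤ × ℤ)) := by
    simp only [Finset.mem_product, Finset.mem_insert, Finset.mem_singleton,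
      ← sq_eq_sq_iff_eq_or_eq_neg]
    exact ⟨fun hq => sq_eq_sq_of_two_mul_sq_add_three_mul_sq hp hxy hq,
      fun hq => by rw [hq.1, hq.2, hxy]⟩
  rw [Nat.card_congr (Equiv.subtypeEquivRight hsol), Nat.card_eq_fintype_card,
    Fintype.card_coe, Finset.card_product, Finset.card_pair (by omega),
    Finset.card_pair (by omega)]
end

section
/- Let m be a squarefree positive integer with m ≡ 11 (mod 24). If m is representable by 5x² + 2xy + 11y² (with integers x,y), then every prime divisor p of m satisfies p ≡ 1, 5, 7, or 11 (mod 24). -/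
theorem jacobiSym_neg_six_eq_neg_one {n : ℕ}
    (hn : n % 24 = 13 ∨ n % 24 = 17 ∨ n % 24 = 19 ∨ n % 24 = 23) :
    jacobiSym (-6) n = -1 := by
  have hodd : Odd n := Nat.odd_iff.mpr (by omega)
  rw [jacobiSym.mod_right (-6) hodd, show 4 * (-6 : ℤ).natAbs = 24 from rfl]
  rcases hn with h | h | h | h <;> rw [h] <;> norm_num

theorem stmt10 (m : ℕ) (hm : 0 < m) (hsf : Squarefree m) (h24 : m % 24 = 11)
    (hrep : ∃ x y : ℤ, (m : ℤ) = 5 * x ^ 2 + 2 * x * y + 11 * y ^ 2) :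
    ∀ p : ℕ, p.Prime → p ∣ m →
      p % 24 = 1 ∨ p % 24 = 5 ∨ p % 24 = 7 ∨ p % 24 = 11 := by
  intro p hp hpm
  obtain ⟨x, y, hxy⟩ := hrep
  have h2 : ¬ 2 ∣ p := fun h => by have := h.trans hpm; omega
  have h3 : ¬ 3 ∣ p := fun h => by have := h.trans hpm; omega
  by_contra hcon
  have : Fact p.Prime := ⟨hp⟩
  have hpZ : Prime (p : ℤ) := Nat.prime_iff_prime_int.mp hp
  have hJ : jacobiSym (-6) p = -1 := jacobiSym_neg_six_eq_neg_one (by omega)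
  have hdvd : (p : ℤ) ∣ (5 * x + y) ^ 2 - (-6) * (3 * y) ^ 2 := by
    have h : (5 * x + y) ^ 2 - (-6) * (3 * y) ^ 2 = 5 * (m : ℤ) := by rw [hxy]; ring
    rw [h]
    exact (Int.natCast_dvd_natCast.mpr hpm).mul_left 5
  obtain ⟨hx, hy⟩ := jacobiSym.prime_dvd_of_eq_neg_one hJ hdvd
  have hp_not_dvd {q : ℕ} (hq : q.Prime) (hne : p ≠ q) : ¬ (p : ℤ) ∣ (q : ℤ) := fun h =>
    hne ((Nat.prime_dvd_prime_iff_eq hp hq).mp (Int.natCast_dvd_natCast.mp h))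
  have hpy : (p : ℤ) ∣ y :=
    (hpZ.dvd_or_dvd hy).resolve_left (hp_not_dvd (q := 3) Nat.prime_three (by rintro rfl; omega))
  have hpx : (p : ℤ) ∣ x :=
    (hpZ.dvd_or_dvd ((dvd_add_left hpy).mp hx)).resolve_left
      (hp_not_dvd (q := 5) Nat.prime_five (by rintro rfl; omega))
  have hpp : p * p ∣ m := by
    obtain ⟨a, rfl⟩ := hpx
    obtain ⟨b, rfl⟩ := hpy
    have h : ((p * p : ℕ) : ℤ) ∣ (m : ℤ) :=
      ⟨5 * a ^ 2 + 2 * a * b + 11 * b ^ 2, by rw [hxy]; push_cast; ring⟩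
    exact Int.natCast_dvd_natCast.mp h
  exact hp.not_isUnit (hsf p hpp)
end

section
/- Let m be a squarefree positive integer, m ≡ 11 (mod 24), with exactly t prime factors, all of which satisfy (−6/p) = 1. Then R(m, 2x² + 27y²) + 2R(m, 5x² + 2xy + 11y²) = 2^{t+1}. -/
/-- The number of square roots of `a` modulo a squarefree `m` all of whose prime factors `p` are
odd with `(a / p) = 1`. -/
theorem card_sqrts_zmod_of_squarefree (a : ℤ) (m : ℕ) (hsf : Squarefree m)
    (hodd : Odd m) (hJ : ∀ p ∈ m.primeFactors, jacobiSym a p = 1) :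
    Nat.card {h : ZMod m // h ^ 2 = (a : ZMod m)} = 2 ^ m.primeFactors.card := by
  induction m using Nat.recOnPosPrimePosCoprime with
  | zero => simp at hodd
  | one =>
    have : Unique {h : ZMod 1 // h ^ 2 = (a : ZMod 1)} :=
      { default := ⟨0, Subsingleton.elim _ _⟩
        uniq := fun _ => Subsingleton.elim _ _ }
    simp
  | prime_pow p n hp hn =>
    obtain rfl : n = 1 := by
      have := (Nat.squarefree_pow_iff hp.ne_one hn.ne').1 hsf
      exact this.2
    rw [pow_one] at *
    have : Fact p.Prime := ⟨hp⟩
    have hp2 : p ≠ 2 := by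
      rintro rfl
      exact absurd hodd (by decide)
    have h1 := legendreSym.card_sqrts p hp2 a
    have h2 := hJ p (by simp [hp.primeFactors])
    rw [← jacobiSym.legendreSym.to_jacobiSym] at h2
    rw [h2] at h1
    rw [hp.primeFactors, Finset.card_singleton, pow_one]
    have h3 : Nat.card {h : ZMod p // h ^ 2 = (a : ZMod p)} =
        ({x : ZMod p | x ^ 2 = (a : ZMod p)} : Set (ZMod p)).toFinset.card := by
      rw [Set.toFinset_card, ← Nat.card_eq_fintype_card]
      rfl
    rw [h3]
    exact_mod_cast h1
  | coprime x y hx hy hxy ihx ihy =>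
    have hx0 : x ≠ 0 := by omega
    have hy0 : y ≠ 0 := by omega
    have hsf' := (Nat.squarefree_mul hxy).1 hsf
    have hodd' := Nat.odd_mul.1 hodd
    rw [Nat.primeFactors_mul hx0 hy0] at hJ
    rw [Nat.Coprime.primeFactors_mul hxy,
      Finset.card_union_of_disjoint (Nat.Coprime.disjoint_primeFactors hxy), pow_add,
      ← ihx hsf'.1 hodd'.1 fun p hp => hJ p (Finset.mem_union_left _ hp),
      ← ihy hsf'.2 hodd'.2 fun p hp => hJ p (Finset.mem_union_right _ hp), ← Nat.card_prod]
    refine Nat.card_congr (Equiv.trans ?_ (Equiv.subtypeProdEquivProd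
      (p := fun h : ZMod x => h ^ 2 = (a : ZMod x)) (q := fun h : ZMod y => h ^ 2 = (a : ZMod y))))
    refine (ZMod.chineseRemainder hxy).toEquiv.subtypeEquiv fun h => ?_
    rw [← (ZMod.chineseRemainder hxy).injective.eq_iff, map_pow, map_intCast, Prod.ext_iff]
    simp

/-- Thue's lemma: every residue class `h` modulo `m` is a quotient of small integers. -/
theorem ZMod.exists_abs_le_eq_mul {m A B : ℕ} (hm : 0 < m) (hAB : m < (A + 1) * (B + 1))
    (h : ZMod m) :
    ∃ a b : ℤ, (a ≠ 0 ∨ b ≠ 0) ∧ |a| ≤ A ∧ |b| ≤ B ∧ (a : ZMod m) = h * b := by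
  have : NeZero m := ⟨hm.ne'⟩
  let s := Finset.range (A + 1) ×ˢ Finset.range (B + 1)
  have hcard : (Finset.univ : Finset (ZMod m)).card < s.card := by
    simpa [s, Finset.card_univ, ZMod.card] using hAB
  obtain ⟨u, hu, v, hv, huv, heq⟩ := Finset.exists_ne_map_eq_of_card_lt_of_maps_to hcard
    (f := fun q : ℕ × ℕ => (q.1 : ZMod m) - h * q.2) (fun _ _ => Finset.mem_univ _)
  simp only [s, Finset.mem_product, Finset.mem_range] at hu hv
  refine ⟨u.1 - v.1, u.2 - v.2, ?_, abs_le.2 (by omega), abs_le.2 (by omega), ?_⟩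
  · by_contra! hc
    exact huv (Prod.ext (by omega) (by omega))
  · push_cast
    linear_combination heq

/-- If `m` is odd and `m ≡ 2 (mod 3)`, every square root `h` of `-6` modulo `m` comes from a
representation of `m` by `2x² + 3y²`. -/
theorem exists_two_sq_add_three_sq {m : ℕ} (hodd : m % 2 = 1) (hm3 : m % 3 = 2) (h : ZMod m)
    (hh : h ^ 2 = -6) :
    ∃ q : ℤ × ℤ, 2 * q.1 ^ 2 + 3 * q.2 ^ 2 = (m : ℤ) ∧ (2 * q.1 : ZMod m) = h * q.2 := by
  have hm : 0 < m := by omega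
  have hAB : m < ((2 * m).sqrt + 1) * ((m / 2).sqrt + 1) := by
    have h1 : 2 * m < ((2 * m).sqrt + 1) ^ 2 := Nat.lt_succ_sqrt' _
    have h2 : m < 2 * ((m / 2).sqrt + 1) ^ 2 := by
      have : m / 2 < ((m / 2).sqrt + 1) ^ 2 := Nat.lt_succ_sqrt' _
      omega
    refine lt_of_pow_lt_pow_left₀ 2 (Nat.zero_le _) ?_
    nlinarith
  obtain ⟨a, b, hab, ha, hb, heq⟩ := ZMod.exists_abs_le_eq_mul hm hAB h
  have ha2 : a ^ 2 ≤ 2 * m := by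
    rw [← sq_abs]
    exact (pow_le_pow_left₀ (abs_nonneg a) ha 2).trans (by exact_mod_cast Nat.sqrt_le' _)
  have hb2 : 2 * b ^ 2 < m := by
    have h1 : b ^ 2 ≤ (m / 2 : ℕ) := by
      rw [← sq_abs]
      exact (pow_le_pow_left₀ (abs_nonneg b) hb 2).trans (by exact_mod_cast Nat.sqrt_le' _)
    omega
  obtain ⟨k, hk⟩ : (m : ℤ) ∣ a ^ 2 + 6 * b ^ 2 := by
    rw [← ZMod.intCast_zmod_eq_zero_iff_dvd]
    push_cast
    rw [heq]
    linear_combination (b : ZMod m) ^ 2 * hh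
  have hmZ : (0 : ℤ) < m := by exact_mod_cast hm
  have hpos : 0 < a ^ 2 + 6 * b ^ 2 := by
    rcases hab with h0 | h0 <;> positivity
  have hk0 : 0 < k := by
    by_contra! hc
    nlinarith
  have hk5 : k < 5 := by
    by_contra! hc
    nlinarith
  have ha3 : a ^ 2 % 3 = 0 ∨ a ^ 2 % 3 = 1 := by
    rcases (by omega : a % 3 = 0 ∨ a % 3 = 1 ∨ a % 3 = 2) with h0 | h0 | h0 <;>
      simp [pow_two, Int.mul_emod, h0]
  interval_cases k
  · omega
  · obtain ⟨c, rfl⟩ : (2 : ℤ) ∣ a := Int.prime_two.dvd_of_dvd_pow (n := 2) (by omega)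
    refine ⟨(c, b), by linarith, ?_⟩
    push_cast at heq
    exact heq
  · obtain ⟨c, rfl⟩ : (3 : ℤ) ∣ a := Int.prime_three.dvd_of_dvd_pow (n := 2) (by omega)
    refine ⟨(b, -c), by linarith, ?_⟩
    have h3 : IsUnit (3 : ZMod m) :=
      (ZMod.isUnit_iff_coprime 3 m).2 ((Nat.Prime.coprime_iff_not_dvd (by norm_num)).2 (by omega))
    refine h3.mul_left_cancel ?_
    push_cast at heq ⊢
    linear_combination h * heq + (b : ZMod m) * hh
  · omega

/-- In a representation of an odd squarefree `m` by `2x² + 3y²`, `y` is prime to `m`. -/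
theorem isUnit_of_two_sq_add_three_sq {m : ℕ} (hsf : Squarefree m) (hodd : m % 2 = 1)
    {x y : ℤ} (hxy : 2 * x ^ 2 + 3 * y ^ 2 = (m : ℤ)) : IsUnit (y : ZMod m) := by
  rw [ZMod.coe_int_isUnit_iff_isCoprime, Int.isCoprime_iff_gcd_eq_one]
  refine Nat.coprime_of_dvd fun p hp hpm hpy => ?_
  have hpm' : p ∣ m := by simpa using hpm
  have hpy' : (p : ℤ) ∣ y := Int.natCast_dvd.2 hpy
  have hpp : Prime (p : ℤ) := Nat.prime_iff_prime_int.1 hp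
  have hpx : (p : ℤ) ∣ x := by
    have h1 : (p : ℤ) ∣ 2 * x ^ 2 := by
      rw [eq_sub_of_add_eq hxy]
      exact dvd_sub (Int.natCast_dvd_natCast.2 hpm') ((dvd_pow hpy' two_ne_zero).mul_left 3)
    rcases hpp.dvd_or_dvd h1 with h2 | h2
    · have : p ∣ 2 := by exact_mod_cast h2
      obtain rfl := (Nat.prime_dvd_prime_iff_eq hp Nat.prime_two).1 this
      omega
    · exact hpp.dvd_of_dvd_pow h2
  have hpp2 : ((p * p : ℕ) : ℤ) ∣ m := by
    push_cast
    rw [← hxy, ← pow_two]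
    exact dvd_add ((pow_dvd_pow_of_dvd hpx 2).mul_left 2) ((pow_dvd_pow_of_dvd hpy' 2).mul_left 3)
  exact hp.one_lt.ne' (Nat.isUnit_iff.1 (hsf p (Int.natCast_dvd_natCast.1 hpp2)))

/-- Representations of `m` by `2x² + 3y²` giving the same square root of `-6` modulo `m` agree up
to sign. -/
theorem eq_or_eq_neg_of_two_sq_add_three_sq {m : ℕ} (hm : 0 < m) {x y x' y' : ℤ}
    (h : 2 * x ^ 2 + 3 * y ^ 2 = (m : ℤ)) (h' : 2 * x' ^ 2 + 3 * y' ^ 2 = (m : ℤ))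
    (hdvd : (m : ℤ) ∣ x * y' - x' * y) :
    (x = x' ∧ y = y') ∨ (x = -x' ∧ y = -y') := by
  have hmZ : (m : ℤ) ≠ 0 := by exact_mod_cast hm.ne'
  have key : (2 * x * x' + 3 * y * y') ^ 2 + 6 * (x * y' - x' * y) ^ 2 = (m : ℤ) ^ 2 := by
    rw [pow_two (m : ℤ)]
    nth_rw 1 [← h]
    rw [← h']
    ring
  have hD : x * y' - x' * y = 0 := by
    obtain ⟨c, hc⟩ := hdvd
    by_cases hc0 : c = 0
    · simp [hc, hc0]
    · have h1 : 0 < c ^ 2 := by positivity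
      have h2 : (0 : ℤ) < (m : ℤ) ^ 2 := by positivity
      rw [hc] at key
      nlinarith [sq_nonneg (2 * x * x' + 3 * y * y')]
  have hE : (2 * x * x' + 3 * y * y') ^ 2 = (m : ℤ) ^ 2 := by rw [← key, hD]; ring
  rcases sq_eq_sq_iff_eq_or_eq_neg.1 hE with hE | hE
  · left
    constructor <;> apply mul_left_cancel₀ hmZ
    · linear_combination (-x) * h' + x' * hE + 3 * y' * hD
    · linear_combination (-y) * h' + y' * hE - 2 * x' * hD
  · right
    constructor <;> apply mul_left_cancel₀ hmZ
    · linear_combination (-x) * h' + x' * hE + 3 * y' * hD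
    · linear_combination (-y) * h' + y' * hE - 2 * x' * hD

/-- Dirichlet's count of the representations by `2x² + 3y²`. -/
theorem card_two_sq_add_three_sq {m : ℕ} (hsf : Squarefree m) (hodd : m % 2 = 1)
    (hm3 : m % 3 = 2) (hJ : ∀ p ∈ m.primeFactors, jacobiSym (-6) p = 1) :
    Nat.card {q : ℤ × ℤ // 2 * q.1 ^ 2 + 3 * q.2 ^ 2 = (m : ℤ)} =
      2 ^ (m.primeFactors.card + 1) := by
  have hm : 0 < m := by omega
  have hmZ : (0 : ℤ) < m := by exact_mod_cast hm
  choose r hr hrh using fun h : {h : ZMod m // h ^ 2 = ((-6 : ℤ) : ZMod m)} =>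
    exists_two_sq_add_three_sq hodd hm3 h.1 (by simpa using h.2)
  have hcard := card_sqrts_zmod_of_squarefree (-6) m hsf (Nat.odd_iff.2 hodd) hJ
  have hsq : ∀ ε : ℤˣ, (ε : ℤ) ^ 2 = 1 := fun ε => by
    rcases Int.units_eq_one_or ε with rfl | rfl <;> simp
  let f : {h : ZMod m // h ^ 2 = ((-6 : ℤ) : ZMod m)} × ℤˣ →
      {q : ℤ × ℤ // 2 * q.1 ^ 2 + 3 * q.2 ^ 2 = (m : ℤ)} := fun z =>
    ⟨((z.2 : ℤ) * (r z.1).1, (z.2 : ℤ) * (r z.1).2), by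
      linear_combination hr z.1 + (2 * (r z.1).1 ^ 2 + 3 * (r z.1).2 ^ 2) * hsq z.2⟩
  have hf : f.Bijective := by
    constructor
    · rintro ⟨h, ε⟩ ⟨h', ε'⟩ heq
      obtain ⟨h1, h2⟩ := Prod.ext_iff.1 (Subtype.ext_iff.1 heq)
      simp only [f] at h1 h2
      have hrel := hrh h
      have hrel' := hrh h'
      have hy := isUnit_of_two_sq_add_three_sq hsf hodd (f (h, ε)).2
      have hhh : h = h' := by
        apply Subtype.ext
        refine hy.mul_right_cancel ?_
        have h1m := congrArg (Int.cast : ℤ → ZMod m) h1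
        have h2m := congrArg (Int.cast : ℤ → ZMod m) h2
        simp only [f]
        push_cast at h1m h2m ⊢
        linear_combination -(ε : ZMod m) * hrel + (ε' : ZMod m) * hrel' + 2 * h1m - h'.1 * h2m
      subst hhh
      have hεε : ((ε : ℤ) - ε') * m = 0 := by
        linear_combination -((ε : ℤ) - ε') * hr h + 2 * (r h).1 * h1 + 3 * (r h).2 * h2
      have : (ε : ℤ) = ε' := by
        have := (mul_eq_zero.1 hεε).resolve_right hmZ.ne'
        linarith
      rw [Units.ext this]
    · rintro ⟨⟨x, y⟩, hxy⟩
      obtain ⟨u, hu⟩ := isUnit_of_two_sq_add_three_sq hsf hodd hxy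
      have huinv : (y : ZMod m) * (↑u⁻¹ : ZMod m) = 1 := by rw [← hu]; exact u.mul_inv
      have hxym : (2 * x ^ 2 + 3 * y ^ 2 : ZMod m) = 0 := by
        have := congrArg (Int.cast : ℤ → ZMod m) hxy
        push_cast at this
        simpa using this
      let h : {h : ZMod m // h ^ 2 = ((-6 : ℤ) : ZMod m)} := ⟨2 * x * (↑u⁻¹ : ZMod m), by
        push_cast
        linear_combination 2 * (↑u⁻¹ : ZMod m) ^ 2 * hxym -
          6 * ((y : ZMod m) * (↑u⁻¹ : ZMod m) + 1) * huinv⟩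
      have hrel : (2 * x : ZMod m) = h.1 * y := by
        simp only [h]
        linear_combination -(2 * x : ZMod m) * huinv
      have h2 : IsUnit (2 : ZMod m) := (ZMod.isUnit_iff_coprime 2 m).2
        ((Nat.Prime.coprime_iff_not_dvd (by norm_num)).2 (by omega))
      have hdvd : (m : ℤ) ∣ x * (r h).2 - (r h).1 * y := by
        rw [← ZMod.intCast_zmod_eq_zero_iff_dvd]
        refine h2.mul_left_cancel ?_
        push_cast
        linear_combination ((r h).2 : ZMod m) * hrel - (y : ZMod m) * hrh h
      rcases eq_or_eq_neg_of_two_sq_add_three_sq hm hxy (hr h) hdvd with ⟨h1, h2⟩ | ⟨h1, h2⟩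
      · exact ⟨(h, 1), by simp [f, ← h1, ← h2]⟩
      · exact ⟨(h, -1), by simp [f, ← neg_eq_iff_eq_neg.2 h1, ← neg_eq_iff_eq_neg.2 h2]⟩
  rw [← Nat.card_congr (Equiv.ofBijective f hf), Nat.card_prod, hcard, pow_succ]
  simp

/-- Sorting the representations by `2x² + 3y²` according to `y ≡ 0, x, -x (mod 3)`. -/
theorem card_two_sq_add_three_sq_eq_add {m : ℕ} (hm3 : m % 3 = 2)
    (hfin : Finite {q : ℤ × ℤ // 2 * q.1 ^ 2 + 3 * q.2 ^ 2 = (m : ℤ)}) :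
    Nat.card {q : ℤ × ℤ // 2 * q.1 ^ 2 + 27 * q.2 ^ 2 = (m : ℤ)} +
      2 * Nat.card {q : ℤ × ℤ // 5 * q.1 ^ 2 + 2 * q.1 * q.2 + 11 * q.2 ^ 2 = (m : ℤ)} =
      Nat.card {q : ℤ × ℤ // 2 * q.1 ^ 2 + 3 * q.2 ^ 2 = (m : ℤ)} := by
  let f : {q : ℤ × ℤ // 2 * q.1 ^ 2 + 27 * q.2 ^ 2 = (m : ℤ)} →
      {q : ℤ × ℤ // 2 * q.1 ^ 2 + 3 * q.2 ^ 2 = (m : ℤ)} := fun q =>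
    ⟨(q.1.1, 3 * q.1.2), by linear_combination q.2⟩
  let g : ℤˣ × {q : ℤ × ℤ // 5 * q.1 ^ 2 + 2 * q.1 * q.2 + 11 * q.2 ^ 2 = (m : ℤ)} →
      {q : ℤ × ℤ // 2 * q.1 ^ 2 + 3 * q.2 ^ 2 = (m : ℤ)} := fun z =>
    ⟨(z.2.1.1 + 2 * z.2.1.2, z.1 * (z.2.1.1 - z.2.1.2)), by
      rcases Int.units_eq_one_or z.1 with h | h <;> rw [h] <;> push_cast <;>
        linear_combination z.2.2⟩
  have hx3 : ∀ q : {q : ℤ × ℤ // 2 * q.1 ^ 2 + 3 * q.2 ^ 2 = (m : ℤ)}, ¬ (3 : ℤ) ∣ q.1.1 := by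
    rintro ⟨⟨x, y⟩, hxy⟩ ⟨c, rfl⟩
    simp only at hxy
    have : (m : ℤ) = 3 * (6 * c ^ 2 + y ^ 2) := by linarith
    omega
  have hf : f.Injective := by
    rintro ⟨⟨x, y⟩, h⟩ ⟨⟨x', y'⟩, h'⟩ heq
    simp only [f, Subtype.mk.injEq, Prod.mk.injEq] at heq ⊢
    omega
  have hg : g.Injective := by
    rintro ⟨ε, q⟩ ⟨ε', q'⟩ heq
    have hq := hx3 (g (ε, q))
    obtain ⟨⟨x, y⟩, h⟩ := q
    obtain ⟨⟨x', y'⟩, h'⟩ := q'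
    rcases Int.units_eq_one_or ε with rfl | rfl <;> rcases Int.units_eq_one_or ε' with rfl | rfl <;>
    simp [g] at heq hq ⊢ <;> omega
  have hfg : ∀ p z, f p ≠ g z := by
    rintro ⟨⟨x, y⟩, h⟩ ⟨ε, q⟩ heq
    have hq := hx3 (g (ε, q))
    obtain ⟨⟨x', y'⟩, h'⟩ := q
    rcases Int.units_eq_one_or ε with rfl | rfl <;> simp [f, g] at heq hq <;> omega
  have hbij : (Sum.elim f g).Bijective := by
    refine ⟨hf.sumElim hg hfg, ?_⟩
    rintro ⟨⟨x, y⟩, h⟩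
    have hq := hx3 ⟨(x, y), h⟩
    simp only at hq h
    have hcases : 3 ∣ y ∨ 3 ∣ x - y ∨ 3 ∣ x + y := by
      rcases (by omega : x % 3 = 1 ∨ x % 3 = 2) with hx | hx <;> omega
    rcases hcases with ⟨c, rfl⟩ | ⟨c, hc⟩ | ⟨c, hc⟩
    · exact ⟨.inl ⟨(x, c), by linear_combination h⟩, rfl⟩
    · obtain rfl : x = y + 3 * c := by linarith
      refine ⟨.inr (1, ⟨(y + c, c), by linear_combination h⟩), ?_⟩
      simp [g]
      omega
    · obtain rfl : x = -y + 3 * c := by linarith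
      refine ⟨.inr (-1, ⟨(-y + c, c), by linear_combination h⟩), ?_⟩
      simp [g]
      omega
  have := Finite.of_injective f hf
  have := Finite.of_injective g hg
  have := Finite.of_injective (fun q => g (1, q)) (hg.comp (Prod.mk_right_injective 1))
  rw [← Nat.card_congr (Equiv.ofBijective _ hbij), Nat.card_sum, Nat.card_prod]
  simp

theorem stmt11 (m t : ℕ) (hm : 0 < m) (hsf : Squarefree m) (h24 : m % 24 = 11)
    (ht : m.primeFactors.card = t)
    (hJ : ∀ p ∈ m.primeFactors, jacobiSym (-6) p = 1) :
    Nat.card {q : ℤ × ℤ // 2 * q.1 ^ 2 + 27 * q.2 ^ 2 = (m : ℤ)} +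
      2 * Nat.card {q : ℤ × ℤ // 5 * q.1 ^ 2 + 2 * q.1 * q.2 + 11 * q.2 ^ 2 = (m : ℤ)} =
      2 ^ (t + 1) := by
  have hcard := card_two_sq_add_three_sq hsf (by omega) (by omega) hJ
  rw [card_two_sq_add_three_sq_eq_add (by omega)
    (Nat.finite_of_card_ne_zero (by rw [hcard]; positivity)), hcard, ht]
end
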